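/- Let i, j with |i−j| > 1 and let x be a Kostant partition with e_i(x) ≠ 0. Then ε_j(e_i(x)) = ε_j(x) and ε̂_j(e_i(x)) = ε̂_j(x) (Stembridge axiom S1 for the modified operators, for both string statistics, in the orthogonal case). -/

import Mathlib

open scoped BigOperators

namespace KFC

/-- A (candidate) root is a pair of 1-based indices. -/
abbrev Root : Type := ℕ × ℕ

/-- A Kostant partition is encoded as a multiplicity function on pairs. -/
abbrev KPf : Type := Root → ℕ

/-- An entry of a signed word: a sign (`true` = '+', `false` = '−') together
with the root lying under it. -/
abbrev Entry : Type := Bool × Root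

/-- `p` is a positive root of type `A_{n-1}`. -/
def IsPos (n : ℕ) (p : Root) : Prop := 1 ≤ p.1 ∧ p.1 < p.2 ∧ p.2 ≤ n

/-- `α` is a genuine Kostant partition for type `A_{n-1}`: it is supported on
positive roots. -/
def IsKP (n : ℕ) (α : KPf) : Prop := ∀ p, α p ≠ 0 → IsPos n p

/-- Add one copy of the root `r`. -/
def KPadd (α : KPf) (r : Root) : KPf := fun p => if p = r then α p + 1 else α p

/-- Remove one copy of the root `r`. -/
def KPsub (α : KPf) (r : Root) : KPf := fun p => if p = r then α p - 1 else α p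

/-- Replace one copy of `r` by one copy of `r'`. -/
def KPmove (α : KPf) (r r' : Root) : KPf := KPadd (KPsub α r) r'

/-- The signed word `W_i` of `α`: roots `(a,b)` ordered by decreasing `a` and,
for equal `a`, increasing `b`; a '+' under each `(h,i)` and a '−' under each
`(h,i+1)`. -/
def Wword (n i : ℕ) (α : KPf) : List Entry :=
  ((List.range (n+1)).reverse).flatMap (fun h =>
    List.replicate (α (h, i)) ((true, (h, i)) : Entry) ++
    List.replicate (α (h, i+1)) ((false, (h, i+1)) : Entry))

/-- The signed word `W_i*` of `α`: roots `(a,b)` ordered by increasing `b` and,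
for equal `b`, decreasing `a`; a '+' under each `(i+1,j)` and a '−' under each
`(i,j)`. -/
def Wstar (n i : ℕ) (α : KPf) : List Entry :=
  (List.range (n+1)).flatMap (fun j =>
    List.replicate (α (i+1, j)) ((true, (i+1, j)) : Entry) ++
    List.replicate (α (i, j)) ((false, (i, j)) : Entry))

/-- One step of the left-to-right reduction: a new '+' cancels the rightmost
surviving '−' (the surviving word always has the shape `+^a −^b`). -/
def redStep (s : List Entry) (e : Entry) : List Entry :=
  match e.1, s.getLast? with
  | true, some (false, _) => s.dropLast
  | _, _ => s ++ [e]

/-- The reduced word (list of surviving entries, in order). -/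
def reduceW (w : List Entry) : List Entry := w.foldl redStep []

def plusCt (w : List Entry) : ℕ := (w.filter (fun e => e.1)).length
def minusCt (w : List Entry) : ℕ := (w.filter (fun e => !e.1)).length

/-- `a_i`: number of '+' in the reduced word of `W_i`. -/
def aSt (n i : ℕ) (α : KPf) : ℕ := plusCt (reduceW (Wword n i α))
/-- `b_i`: number of '−' in the reduced word of `W_i`. -/
def bSt (n i : ℕ) (α : KPf) : ℕ := minusCt (reduceW (Wword n i α))
/-- `a_i*`. -/
def aStar (n i : ℕ) (α : KPf) : ℕ := plusCt (reduceW (Wstar n i α))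
/-- `b_i*`. -/
def bStar (n i : ℕ) (α : KPf) : ℕ := minusCt (reduceW (Wstar n i α))
/-- `u_i`: number of '+' in the reduced word of `W_i* W_i`. -/
def uSt (n i : ℕ) (α : KPf) : ℕ := plusCt (reduceW (Wstar n i α ++ Wword n i α))
/-- `v_i`: number of '−' in the reduced word of `W_i* W_i`. -/
def vSt (n i : ℕ) (α : KPf) : ℕ := minusCt (reduceW (Wstar n i α ++ Wword n i α))

/-- The root under the rightmost surviving '+'. -/
def lastPlus (w : List Entry) : Option Root :=
  (((reduceW w).filter (fun e => e.1)).getLast?).map Prod.snd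

/-- The root under the leftmost surviving '−'. -/
def headMinus (w : List Entry) : Option Root :=
  (((reduceW w).filter (fun e => !e.1)).head?).map Prod.snd

/-- The operator `f̃_i`. -/
def ftilde (n i : ℕ) (α : KPf) : Option KPf :=
  match lastPlus (Wword n i α) with
  | some r => some (KPmove α r (r.1, i+1))
  | none => some (KPadd α (i, i+1))

/-- The operator `ẽ_i`. -/
def etilde (n i : ℕ) (α : KPf) : Option KPf :=
  match headMinus (Wword n i α) with
  | some r => if r = (i, i+1) then some (KPsub α (i, i+1)) else some (KPmove α r (r.1, i))
  | none => none

/-- The operator `f̃_i*`. -/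
def ftildeS (n i : ℕ) (α : KPf) : Option KPf :=
  match lastPlus (Wstar n i α) with
  | some r => some (KPmove α r (i, r.2))
  | none => some (KPadd α (i, i+1))

/-- The operator `ẽ_i*`. -/
def etildeS (n i : ℕ) (α : KPf) : Option KPf :=
  match headMinus (Wstar n i α) with
  | some r => if r = (i, i+1) then some (KPsub α (i, i+1)) else some (KPmove α r (i+1, r.2))
  | none => none

/-- The modified operator `f_i`. -/
def fop (n i : ℕ) (α : KPf) : Option KPf :=
  if bStar n i α < aSt n i α then ftilde n i α
  else if 0 < aStar n i α then ftildeS n i α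
  else none

/-- The modified operator `e_i`. -/
def eop (n i : ℕ) (α : KPf) : Option KPf :=
  if bStar n i α ≤ aSt n i α then
    (if 0 < bSt n i α ∧ headMinus (Wword n i α) ≠ some (i, i+1) then etilde n i α else none)
  else
    (if headMinus (Wstar n i α) ≠ some (i, i+1) then etildeS n i α else none)

/-- The operator `ê_i`. -/
def ehat (n i : ℕ) (α : KPf) : Option KPf :=
  if bStar n i α ≤ aSt n i α then (if 0 < bSt n i α then etilde n i α else none)
  else etildeS n i α

/-- Iterate a partially defined operator (`none` plays the role of `0`). -/
def iterO (g : KPf → Option KPf) : ℕ → KPf → Option KPf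
  | 0, x => some x
  | k+1, x => (g x).bind (iterO g k)

/-- `ε_i(x) = max {k : e_i^k x ≠ 0}`. -/
noncomputable def epsS (n i : ℕ) (x : KPf) : ℕ := sSup {k | iterO (eop n i) k x ≠ none}
/-- `ε̂_i(x) = max {k : ê_i^k x ≠ 0}`. -/
noncomputable def epsHatS (n i : ℕ) (x : KPf) : ℕ := sSup {k | iterO (ehat n i) k x ≠ none}
/-- `φ_i(x) = max {k : f_i^k x ≠ 0}`. -/
noncomputable def phiS (n i : ℕ) (x : KPf) : ℕ := sSup {k | iterO (fop n i) k x ≠ none}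

noncomputable def epsO (n i : ℕ) (o : Option KPf) : ℕ := o.elim 0 (epsS n i)
noncomputable def epsHatO (n i : ℕ) (o : Option KPf) : ℕ := o.elim 0 (epsHatS n i)
noncomputable def phiO (n i : ℕ) (o : Option KPf) : ℕ := o.elim 0 (phiS n i)

/-- `e_l(γ) ≃ 0`. -/
def simZero (n l : ℕ) (γ : KPf) : Prop := eop n l γ ≠ ehat n l γ

/-- `e_l e_m (γ) ≃ 0`. -/
def simZero2 (n l m : ℕ) (γ : KPf) : Prop := ∃ δ, eop n m γ = some δ ∧ simZero n l δ

/-- The box containing all relevant pairs. -/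
def kbox (n : ℕ) : Finset (ℕ × ℕ) := Finset.range (n+1) ×ˢ Finset.range (n+1)

/-- `|α|`: number of parts of the Kostant partition. -/
def kpSize (n : ℕ) (α : KPf) : ℕ := ∑ p ∈ kbox n, α p

/-- The evaluation `ᾱ ∈ ℤ^n` (as a function on 1-based coordinates). -/
def kpEval (n : ℕ) (α : KPf) : ℕ → ℤ :=
  fun k => ∑ p ∈ kbox n, (α p : ℤ) * ((if p.1 = k then 1 else 0) - (if p.2 = k then 1 else 0))

/-- The simple root `α_i = ε_i − ε_{i+1}` as a vector. -/
def srVec (i : ℕ) : ℕ → ℤ := fun k => (if k = i then 1 else 0) - (if k = i+1 then 1 else 0)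

/-- `ρ = (n-1, n-2, …, 1, 0)` (on 1-based coordinates `1..n`). -/
def rhoVec (n : ℕ) : ℕ → ℤ := fun k => (n : ℤ) - k

/-- `⟨γ, α_i^∨⟩ = γ_i − γ_{i+1}`. -/
def pairCo (γ : ℕ → ℤ) (i : ℕ) : ℤ := γ i - γ (i+1)

/-- The permutation of 1-based coordinates induced by `w : Perm (Fin n)`. -/
def extP (n : ℕ) (w : Equiv.Perm (Fin n)) (k : ℕ) : ℕ :=
  if h : 1 ≤ k ∧ k ≤ n then ((w ⟨k - 1, by omega⟩ : Fin n) : ℕ) + 1 else k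

/-- `S_n` acting on `ℤ^n` by permuting coordinates: `(w·v)_k = v_{w⁻¹(k)}`. -/
def permAct (n : ℕ) (w : Equiv.Perm (Fin n)) (v : ℕ → ℤ) : ℕ → ℤ :=
  fun k => v (extP n w⁻¹ k)

/-- The simple transposition `s_i = (i, i+1)` (1-based). -/
def sT (n i : ℕ) : Equiv.Perm (Fin n) :=
  if h : 1 ≤ i ∧ i < n then Equiv.swap ⟨i - 1, by omega⟩ ⟨i, h.2⟩ else 1

/-- Coxeter length = number of inversions. -/
def lenP (n : ℕ) (w : Equiv.Perm (Fin n)) : ℕ :=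
  (Finset.univ.filter (fun p : Fin n × Fin n => p.1 < p.2 ∧ w p.2 < w p.1)).card

/-- The left weak Bruhat order: `u ≤ w` iff `ℓ(w) = ℓ(w u⁻¹) + ℓ(u)`. -/
def leftWeakLE (n : ℕ) (u w : Equiv.Perm (Fin n)) : Prop :=
  lenP n w = lenP n (w * u⁻¹) + lenP n u

/-- `λ + ρ` as a vector. -/
def lamRho (n : ℕ) (lam : ℕ → ℤ) : ℕ → ℤ := fun k => lam k + rhoVec n k

/-- `(w, α) ∈ S_{λ,μ}`, i.e. `ᾱ = w(λ+ρ) − (μ+ρ)`. -/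
def InS (n : ℕ) (lam mu : ℕ → ℤ) (w : Equiv.Perm (Fin n)) (α : KPf) : Prop :=
  IsKP n α ∧ ∀ k, 1 ≤ k → k ≤ n →
    kpEval n α k = permAct n w (lamRho n lam) k - (mu k + rhoVec n k)

/-- A directed edge `(w,α) →^i (s_i w, β)` of the `Φ`-graph. -/
def PhiEdge (n : ℕ) (lam mu : ℕ → ℤ) (v v' : Equiv.Perm (Fin n) × KPf) : Prop :=
  InS n lam mu v.1 v.2 ∧ InS n lam mu v'.1 v'.2 ∧
  ∃ i, 1 ≤ i ∧ i ≤ n - 1 ∧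
    pairCo (permAct n v.1 (lamRho n lam)) i < 0 ∧
    v'.1 = sT n i * v.1 ∧
    iterO (fop n i) (-(pairCo (permAct n v.1 (lamRho n lam)) i)).toNat v.2 = some v'.2

/-- Being in the same connected component of (the underlying undirected graph of)
the `Φ`-graph. -/
def Conn (n : ℕ) (lam mu : ℕ → ℤ) (v v' : Equiv.Perm (Fin n) × KPf) : Prop :=
  Relation.ReflTransGen (fun a b => PhiEdge n lam mu a b ∨ PhiEdge n lam mu b a) v v'

/-- `(w,β)` has a broken hexagon, broken by `Φ_i` after `Φ_j`. -/
def BrokenHexAt (n : ℕ) (lam mu : ℕ → ℤ) (w : Equiv.Perm (Fin n)) (β : KPf) (i j : ℕ) : Prop :=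
  (j = i + 1 ∨ i = j + 1) ∧ 1 ≤ i ∧ i ≤ n - 1 ∧ 1 ≤ j ∧ j ≤ n - 1 ∧
  0 < pairCo (permAct n w (lamRho n lam)) i ∧
  0 < pairCo (permAct n w (lamRho n lam)) j ∧
  iterO (eop n i) (pairCo (permAct n w (lamRho n lam)) i).toNat β ≠ none ∧
  ∃ δ, iterO (eop n j) (pairCo (permAct n w (lamRho n lam)) j).toNat β = some δ ∧
    epsS n i δ < (pairCo (permAct n w (lamRho n lam)) i).toNat +
      (pairCo (permAct n w (lamRho n lam)) j).toNat

/-- `γ` is obtained from `β` by an initial segment of the operator sequence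
(`e_i` applied `ki` times, then `e_j` applied `ki+kj` times, then `e_i` applied
`kj` times). -/
def alongPath (n i j ki kj : ℕ) (β γ : KPf) : Prop :=
  (∃ a ≤ ki, iterO (eop n i) a β = some γ) ∨
  (∃ b ≤ ki + kj, (iterO (eop n i) ki β).bind (iterO (eop n j) b) = some γ) ∨
  (∃ c ≤ kj, ((iterO (eop n i) ki β).bind (iterO (eop n j) (ki + kj))).bind
      (iterO (eop n i) c) = some γ)

/-- Conjecture A: no broken diamonds along the hexagon paths. -/
def ConjA (n : ℕ) (lam mu : ℕ → ℤ) : Prop :=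
  ∀ (w : Equiv.Perm (Fin n)) (β : KPf) (i j : ℕ),
    InS n lam mu w β → 1 ≤ i → i ≤ n - 1 → 1 ≤ j → j ≤ n - 1 → (j = i + 1 ∨ i = j + 1) →
    ∀ ki kj : ℤ,
      ki = pairCo (permAct n w (lamRho n lam)) i →
      kj = pairCo (permAct n w (lamRho n lam)) j →
      0 < ki → 0 < kj →
      iterO (eop n i) ki.toNat β ≠ none → iterO (eop n j) kj.toNat β ≠ none →
      ∀ γ : KPf,
        (alongPath n i j ki.toNat kj.toNat β γ ∨ alongPath n j i kj.toNat ki.toNat β γ) →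
        ¬ (simZero2 n i j γ ∧ simZero2 n j i γ)

/-- Conjecture B: broken hexagons propagate up to the source vertex. -/
def ConjB (n : ℕ) (lam mu : ℕ → ℤ) : Prop :=
  ∀ (w : Equiv.Perm (Fin n)) (β α : KPf) (i j : ℕ),
    InS n lam mu w β → InS n lam mu 1 α → Conn n lam mu (1, α) (w, β) →
    BrokenHexAt n lam mu w β i j → ∃ j', BrokenHexAt n lam mu 1 α i j'

/-- The Kostka–Foulkes polynomial `K_{λ,μ}(t) = Σ_{(w,α) ∈ S_{λ,μ}} sgn(w) t^{|α|}`. -/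
noncomputable def KF (n : ℕ) (lam mu : ℕ → ℤ) : Polynomial ℤ :=
  ∑ᶠ (w : Equiv.Perm (Fin n)) (α : KPf) (_ : InS n lam mu w α),
    ((Equiv.Perm.sign w : ℤ) • (Polynomial.X ^ kpSize n α) : Polynomial ℤ)

end KFC


namespace KFC

/-! ### Words made of blocks `+^(P h) −^(Q h)` -/

/-- The word `∏ +^(P h) −^(Q h)` over `h ∈ L`, with root `r h` under each plus sign and `s h` under
each minus sign of the block `h`. -/
def blockWord (P Q : ℕ → ℕ) (r s : ℕ → Root) (L : List ℕ) : List Entry :=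
  L.flatMap (fun h => List.replicate (P h) ((true, r h) : Entry) ++
    List.replicate (Q h) ((false, s h) : Entry))

/-- The numbers of plus and minus signs in the reduction of a block word. -/
def sig (P Q : ℕ → ℕ) : List ℕ → ℕ × ℕ
  | [] => (0, 0)
  | h :: t => (P h + ((sig P Q t).1 - Q h), (sig P Q t).2 + (Q h - (sig P Q t).1))

/-- The block containing the leftmost surviving minus sign of a block word. -/
def headIdx (P Q : ℕ → ℕ) : List ℕ → Option ℕ
  | [] => none
  | h :: t => if (sig P Q t).1 < Q h then some h else headIdx P Q t

/-- The effect on a reduced word of prepending an entry. -/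
def consRed (e : Entry) (l : List Entry) : List Entry :=
  match e, l with
  | (true, _), l => e :: l
  | (false, _), (true, _) :: t => t
  | (false, _), l => e :: l

lemma redStep_consRed (e f : Entry) (l : List Entry) :
    redStep (consRed e l) f = consRed e (redStep l f) := by
  obtain ⟨be, re⟩ := e
  obtain ⟨bf, rf⟩ := f
  rcases l.eq_nil_or_concat with rfl | ⟨l, ⟨bg, rg⟩, rfl⟩
  · cases be <;> cases bf <;> simp [redStep, consRed]
  · rcases l with _ | ⟨⟨bh, rh⟩, l⟩
    · cases be <;> cases bf <;> cases bg <;> simp [redStep, consRed]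
    · cases be <;> cases bf <;> cases bg <;> cases bh <;>
        simp [redStep, consRed, List.getLast?_cons, List.dropLast_cons_of_ne_nil]

lemma foldl_redStep_consRed (e : Entry) (w l : List Entry) :
    w.foldl redStep (consRed e l) = consRed e (w.foldl redStep l) := by
  induction w generalizing l with
  | nil => rfl
  | cons f w ih => simp only [List.foldl_cons, redStep_consRed, ih]

lemma reduceW_cons (e : Entry) (w : List Entry) : reduceW (e :: w) = consRed e (reduceW w) := by
  have h : redStep [] e = consRed e [] := by
    obtain ⟨b, r⟩ := e
    cases b <;> rfl
  rw [reduceW, List.foldl_cons, h, foldl_redStep_consRed, reduceW]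

lemma reduceW_replicate_plus (p : ℕ) (r : Root) (w : List Entry) :
    reduceW (List.replicate p (true, r) ++ w) = List.replicate p (true, r) ++ reduceW w := by
  induction p with
  | zero => rfl
  | succ p ih => simp [List.replicate_succ, reduceW_cons, ih, consRed]

lemma reduceW_replicate_minus (q : ℕ) (r : Root) (w pl mi : List Entry)
    (hw : reduceW w = pl ++ mi) (hpl : ∀ e ∈ pl, e.1 = true) (hmi : ∀ e ∈ mi, e.1 = false) :
    reduceW (List.replicate q (false, r) ++ w) =
      pl.drop q ++ (List.replicate (q - pl.length) (false, r) ++ mi) := by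
  induction q with
  | zero => simpa using hw
  | succ q ih =>
    rw [List.replicate_succ, List.cons_append, reduceW_cons, ih]
    rcases lt_or_ge q pl.length with h | h
    · have h1 : q - pl.length = 0 := by omega
      have h2 : q + 1 - pl.length = 0 := by omega
      rw [h1, h2, List.drop_eq_getElem_cons h]
      have h3 := hpl _ (List.getElem_mem h)
      rcases hg : pl[q] with ⟨b, r'⟩
      rw [hg] at h3
      obtain rfl : b = true := h3
      simp [consRed]
    · rw [List.drop_eq_nil_of_le h, List.drop_eq_nil_of_le (by omega),
        Nat.succ_sub h, List.replicate_succ]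
      rcases hq : List.replicate (q - pl.length) ((false, r) : Entry) ++ mi with _ | ⟨⟨b, r'⟩, t⟩
      · simp [consRed, hq]
      · have hb : b = false := by
          have hm : ((b, r') : Entry) ∈ List.replicate (q - pl.length) ((false, r) : Entry) ++ mi := by
            simp [hq]
          rcases List.mem_append.1 hm with hm | hm
          · have := List.eq_of_mem_replicate hm
            simp_all
          · exact hmi _ hm
        subst hb
        simp [consRed, hq]

lemma reduceW_blockWord (P Q : ℕ → ℕ) (r s : ℕ → Root) (L : List ℕ) :
    ∃ pl mi, reduceW (blockWord P Q r s L) = pl ++ mi ∧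
      (∀ e ∈ pl, e.1 = true) ∧ (∀ e ∈ mi, e.1 = false) ∧
      pl.length = (sig P Q L).1 ∧ mi.length = (sig P Q L).2 ∧
      mi.head?.map Prod.snd = (headIdx P Q L).map s := by
  induction L with
  | nil => exact ⟨[], [], by simp [blockWord, reduceW, sig, headIdx]⟩
  | cons h t ih =>
    obtain ⟨pl, mi, hw, hpl, hmi, hlp, hlm, hh⟩ := ih
    refine ⟨List.replicate (P h) (true, r h) ++ pl.drop (Q h),
      List.replicate (Q h - pl.length) (false, s h) ++ mi, ?_, ?_, ?_, ?_, ?_, ?_⟩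
    · have : blockWord P Q r s (h :: t) = List.replicate (P h) (true, r h) ++
          (List.replicate (Q h) (false, s h) ++ blockWord P Q r s t) := by
        simp [blockWord]
      rw [this, reduceW_replicate_plus, reduceW_replicate_minus _ _ _ _ _ hw hpl hmi]
      simp
    · intro e he
      rcases List.mem_append.1 he with he | he
      · rw [List.eq_of_mem_replicate he]
      · exact hpl _ (List.mem_of_mem_drop he)
    · intro e he
      rcases List.mem_append.1 he with he | he
      · rw [List.eq_of_mem_replicate he]
      · exact hmi _ he
    · simp [sig, hlp]
    · simp [sig, hlp, hlm, add_comm]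
    · rw [headIdx, ← hlp]
      split_ifs with hlt
      · obtain ⟨k, hk⟩ : ∃ k, Q h - pl.length = k + 1 := ⟨Q h - pl.length - 1, by omega⟩
        simp [hk, List.replicate_succ]
      · have hk : Q h - pl.length = 0 := by omega
        simpa [hk] using hh

lemma stats_blockWord (P Q : ℕ → ℕ) (r s : ℕ → Root) (L : List ℕ) :
    plusCt (reduceW (blockWord P Q r s L)) = (sig P Q L).1 ∧
      minusCt (reduceW (blockWord P Q r s L)) = (sig P Q L).2 ∧
      headMinus (blockWord P Q r s L) = (headIdx P Q L).map s := by
  obtain ⟨pl, mi, hw, hpl, hmi, hlp, hlm, hh⟩ := reduceW_blockWord P Q r s L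
  have h1 : (pl ++ mi).filter (fun e => e.1) = pl := by
    rw [List.filter_append, List.filter_eq_self.2 hpl, List.filter_eq_nil_iff.2, List.append_nil]
    intro e he
    simp [hmi e he]
  have h2 : (pl ++ mi).filter (fun e => !e.1) = mi := by
    rw [List.filter_append, List.filter_eq_nil_iff.2, List.nil_append, List.filter_eq_self.2]
    · intro e he
      simp [hmi e he]
    · intro e he
      simp [hpl e he]
  refine ⟨?_, ?_, ?_⟩
  · rw [plusCt, hw, h1, hlp]
  · rw [minusCt, hw, h2, hlm]
  · rw [headMinus, hw, h2, hh]

lemma sig_congr {P Q P' Q' : ℕ → ℕ} {L : List ℕ} (h : ∀ a ∈ L, P' a = P a ∧ Q' a = Q a) :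
    sig P' Q' L = sig P Q L := by
  induction L with
  | nil => rfl
  | cons a t ih =>
    have ha := h a (by simp)
    simp only [sig, ih fun b hb => h b (by simp [hb]), ha.1, ha.2]

lemma sig_append_congr {P Q P' Q' : ℕ → ℕ} {L M : List ℕ}
    (h : ∀ a ∈ L, P' a = P a ∧ Q' a = Q a) (hM : sig P' Q' M = sig P Q M) :
    sig P' Q' (L ++ M) = sig P Q (L ++ M) := by
  induction L with
  | nil => exact hM
  | cons a t ih =>
    have ha := h a (by simp)
    simp only [List.cons_append, sig, ih fun b hb => h b (by simp [hb]), ha.1, ha.2]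

lemma sig_append_of_zero {P Q : ℕ → ℕ} {L M : List ℕ} (h : ∀ a ∈ L, P a = 0 ∧ Q a = 0) :
    sig P Q (L ++ M) = sig P Q M ∧ headIdx P Q (L ++ M) = headIdx P Q M := by
  induction L with
  | nil => exact ⟨rfl, rfl⟩
  | cons a t ih =>
    have ha := h a (by simp)
    have := ih fun b hb => h b (by simp [hb])
    simp [sig, headIdx, this, ha.1, ha.2]

lemma headIdx_spec {P Q : ℕ → ℕ} {L : List ℕ} {h : ℕ} (hh : headIdx P Q L = some h) :
    h ∈ L ∧ 0 < Q h ∧ 0 < (sig P Q L).2 := by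
  induction L with
  | nil => simp [headIdx] at hh
  | cons a t ih =>
    rw [headIdx] at hh
    split_ifs at hh with hlt
    · obtain rfl := Option.some.inj hh
      simp only [sig, List.mem_cons, true_or, true_and]
      omega
    · have := ih hh
      simp only [sig, List.mem_cons, this.1, or_true, true_and]
      omega

lemma headIdx_eq_none {P Q : ℕ → ℕ} {L : List ℕ} (hh : headIdx P Q L = none) :
    (sig P Q L).2 = 0 := by
  induction L with
  | nil => rfl
  | cons a t ih =>
    rw [headIdx] at hh
    split_ifs at hh with hlt
    have := ih hh
    simp only [sig]
    omega

/-- Turning the leftmost surviving minus sign into a plus sign. -/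
lemma sig_headIdx {P Q P' Q' : ℕ → ℕ} {L : List ℕ} {h : ℕ} (hL : L.Nodup)
    (hh : headIdx P Q L = some h) (hP : P' h = P h + 1) (hQ : Q' h = Q h - 1)
    (hne : ∀ a, a ≠ h → P' a = P a ∧ Q' a = Q a) :
    sig P' Q' L = ((sig P Q L).1 + 1, (sig P Q L).2 - 1) := by
  induction L with
  | nil => simp [headIdx] at hh
  | cons a t ih =>
    rw [headIdx] at hh
    rw [List.nodup_cons] at hL
    split_ifs at hh with hlt
    · obtain rfl := Option.some.inj hh
      have := sig_congr (P := P) (Q := Q) (P' := P') (Q' := Q') (L := t) fun b hb =>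
        hne b (by rintro rfl; exact hL.1 hb)
      simp only [sig, this, hP, hQ, Prod.mk.injEq]
      omega
    · have hs := headIdx_spec hh
      have ha := hne a (by rintro rfl; exact hL.1 hs.1)
      simp only [sig, ih hL.2 hh, ha.1, ha.2, Prod.mk.injEq]
      omega

lemma headIdx_adjacent {P Q : ℕ → ℕ} {L M : List ℕ} {c c' : ℕ} (hN : (L ++ c :: c' :: M).Nodup) :
    (headIdx P Q (L ++ c :: c' :: M) = some c → P c' < Q c) ∧
      (headIdx P Q (L ++ c :: c' :: M) = some c' → Q c ≤ P c' ∧ 0 < Q c') := by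
  induction L with
  | nil =>
    simp only [List.nil_append, List.nodup_cons, List.mem_cons, not_or] at hN ⊢
    constructor
    · intro h
      by_contra hlt
      rw [headIdx, if_neg (by simp only [sig]; omega)] at h
      have := (headIdx_spec h).1
      simp [hN.1.1, hN.1.2] at this
    · intro h
      by_cases h1 : (sig P Q (c' :: M)).1 < Q c
      · rw [headIdx, if_pos h1] at h
        exact absurd (Option.some.inj h) hN.1.1
      · rw [headIdx, if_neg h1] at h
        by_cases h2 : (sig P Q M).1 < Q c'
        · simp only [sig] at h1
          omega
        · rw [headIdx, if_neg h2] at h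
          exact absurd (headIdx_spec h).1 hN.2.1
  | cons a t ih =>
    simp only [List.cons_append, List.nodup_cons, List.mem_append, List.mem_cons, not_or] at hN
    have := ih hN.2
    simp only [List.cons_append, headIdx]
    constructor
    · intro h
      split_ifs at h with h1
      · exact absurd (Option.some.inj h) hN.1.2.1
      · exact this.1 h
    · intro h
      split_ifs at h with h1
      · exact absurd (Option.some.inj h) hN.1.2.2.1
      · exact this.2 h

/-- Moving a redundant plus sign or minus sign to the neighbouring block on the left. -/
lemma sig_adjacent {P Q P' Q' : ℕ → ℕ} {L M : List ℕ} {c c' : ℕ} (hN : (L ++ c :: c' :: M).Nodup)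
    (hne : ∀ a, a ≠ c → a ≠ c' → P' a = P a ∧ Q' a = Q a)
    (h : (Q c < P c' ∧ P' c = P c + 1 ∧ P' c' = P c' - 1 ∧ Q' c = Q c ∧ Q' c' = Q c') ∨
      (P c' ≤ Q c ∧ 0 < Q c' ∧ P' c = P c ∧ P' c' = P c' ∧ Q' c = Q c + 1 ∧ Q' c' = Q c' - 1)) :
    sig P' Q' (L ++ c :: c' :: M) = sig P Q (L ++ c :: c' :: M) := by
  rw [List.nodup_append] at hN
  obtain ⟨-, hN, hd⟩ := hN
  simp only [List.nodup_cons, List.mem_cons, not_or] at hN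
  apply sig_append_congr
  · exact fun a ha => hne a (hd a ha c (by simp)) (hd a ha c' (by simp))
  · have hM : sig P' Q' M = sig P Q M := sig_congr fun a ha =>
      hne a (by rintro rfl; exact hN.1.2 ha) (by rintro rfl; exact hN.2.1 ha)
    simp only [sig, hM, Prod.mk.injEq]
    rcases h with ⟨h1, h2, h3, h4, h5⟩ | ⟨h1, h2, h3, h4, h5, h6⟩
    · rw [h2, h3, h4, h5]; omega
    · rw [h3, h4, h5, h6]; omega

/-! ### The words `W_i` and `W_i*` -/

/-- The blocks of `W_j` apart from the simple root. -/
abbrev colIdx (j : ℕ) : List ℕ := (List.range j).reverse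

/-- The blocks of `W_j*` apart from the simple root. -/
abbrev rowIdx (n j : ℕ) : List ℕ := List.range' (j + 2) (n - 1 - j)

abbrev colSig (j : ℕ) (x : KPf) : ℕ × ℕ := sig (fun h => x (h, j)) (fun h => x (h, j + 1)) (colIdx j)

abbrev rowSig (n j : ℕ) (x : KPf) : ℕ × ℕ :=
  sig (fun c => x (j + 1, c)) (fun c => x (j, c)) (rowIdx n j)

abbrev colHead (j : ℕ) (x : KPf) : Option ℕ :=
  headIdx (fun h => x (h, j)) (fun h => x (h, j + 1)) (colIdx j)

abbrev rowHead (n j : ℕ) (x : KPf) : Option ℕ :=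
  headIdx (fun c => x (j + 1, c)) (fun c => x (j, c)) (rowIdx n j)

lemma range_eq_append_cons {a m : ℕ} (h : a < m) :
    List.range m = List.range a ++ a :: List.range' (a + 1) (m - 1 - a) := by
  obtain ⟨k, rfl⟩ : ∃ k, m = a + (k + 1) := ⟨m - a - 1, by omega⟩
  rw [show a + (k + 1) - 1 - a = k by omega, ← List.range'_succ, List.range_eq_range',
    List.range_eq_range', ← List.range'_append_1, Nat.zero_add]

lemma IsKP.eq_zero {n : ℕ} {x : KPf} (hx : IsKP n x) {p : Root} (hp : ¬ IsPos n p) : x p = 0 := by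
  by_contra h
  exact hp (hx p h)

lemma Wword_stats {n j : ℕ} {x : KPf} (hx : IsKP n x) (hj : j < n) :
    aSt n j x = (colSig j x).1 - x (j, j + 1) ∧
      bSt n j x = (colSig j x).2 + (x (j, j + 1) - (colSig j x).1) ∧
      headMinus (Wword n j x) = if (colSig j x).1 < x (j, j + 1) then some (j, j + 1)
        else (colHead j x).map (fun h => (h, j + 1)) := by
  obtain ⟨h1, h2, h3⟩ := stats_blockWord (fun h => x (h, j)) (fun h => x (h, j + 1))
    (fun h => (h, j)) (fun h => (h, j + 1)) (List.range (n + 1)).reverse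
  have hL : (List.range (n + 1)).reverse =
      (List.range' (j + 1) (n - j)).reverse ++ j :: colIdx j := by
    rw [range_eq_append_cons (show j < n + 1 by omega)]
    simp
  have hz := sig_append_of_zero (P := fun h => x (h, j)) (Q := fun h => x (h, j + 1))
    (L := (List.range' (j + 1) (n - j)).reverse) (M := j :: colIdx j) (by
      intro a ha
      rw [List.mem_reverse, List.mem_range'_1] at ha
      exact ⟨hx.eq_zero fun h => by have := h.2.1; simp at this; omega,
        hx.eq_zero fun h => by have := h.2.1; simp at this; omega⟩)
  have hjj : x (j, j) = 0 := hx.eq_zero fun h => by have := h.2.1; simp at this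
  rw [hL, hz.1] at h1 h2
  rw [hL, hz.2] at h3
  rw [← hL] at h1 h2 h3
  refine ⟨h1.trans ?_, h2.trans rfl, h3.trans ?_⟩
  · simp only [colSig, sig, hjj]; omega
  · simp only [headIdx]; split_ifs <;> rfl

lemma Wstar_stats {n j : ℕ} {x : KPf} (hx : IsKP n x) (hj : j < n) :
    bStar n j x = (rowSig n j x).2 + (x (j, j + 1) - (rowSig n j x).1) ∧
      headMinus (Wstar n j x) = if (rowSig n j x).1 < x (j, j + 1) then some (j, j + 1)
        else (rowHead n j x).map (fun c => (j, c)) := by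
  obtain ⟨h1, h2, h3⟩ := stats_blockWord (fun c => x (j + 1, c)) (fun c => x (j, c))
    (fun c => (j + 1, c)) (fun c => (j, c)) (List.range (n + 1))
  have hL : List.range (n + 1) = List.range (j + 1) ++ (j + 1) :: rowIdx n j := by
    rw [range_eq_append_cons (show j + 1 < n + 1 by omega),
      show n + 1 - 1 - (j + 1) = n - 1 - j by omega]
  have hz := sig_append_of_zero (P := fun c => x (j + 1, c)) (Q := fun c => x (j, c))
    (L := List.range (j + 1)) (M := (j + 1) :: rowIdx n j) (by
      intro a ha
      rw [List.mem_range] at ha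
      exact ⟨hx.eq_zero fun h => by have := h.2.1; simp at this; omega,
        hx.eq_zero fun h => by have := h.2.1; simp at this; omega⟩)
  rw [hL, hz.1] at h1 h2
  rw [hL, hz.2] at h3
  rw [← hL] at h1 h2 h3
  refine ⟨h2.trans rfl, h3.trans ?_⟩
  simp only [headIdx]; split_ifs <;> rfl

lemma colHead_lt {j h : ℕ} {x : KPf} (hh : colHead j x = some h) : h < j := by
  simpa using (headIdx_spec hh).1

lemma rowHead_gt {n j c : ℕ} {x : KPf} (hh : rowHead n j x = some c) : j + 2 ≤ c := by
  have := (headIdx_spec hh).1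
  rw [List.mem_range'_1] at this
  exact this.1

lemma etilde_eq {n j : ℕ} {x : KPf} (hx : IsKP n x) (hj : j < n) :
    etilde n j x = if (colSig j x).1 < x (j, j + 1) then some (KPsub x (j, j + 1))
      else (colHead j x).map (fun h => KPmove x (h, j + 1) (h, j)) := by
  rw [etilde, (Wword_stats hx hj).2.2]
  split_ifs with h
  · simp
  · rcases hh : colHead j x with _ | k
    · simp
    · have := colHead_lt hh
      simp [this.ne]

lemma etildeS_eq {n j : ℕ} {x : KPf} (hx : IsKP n x) (hj : j < n) :
    etildeS n j x = if (rowSig n j x).1 < x (j, j + 1) then some (KPsub x (j, j + 1))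
      else (rowHead n j x).map (fun c => KPmove x (j, c) (j + 1, c)) := by
  rw [etildeS, (Wstar_stats hx hj).2]
  split_ifs with h
  · simp
  · rcases hh : rowHead n j x with _ | k
    · simp
    · have := rowHead_gt hh
      have : k ≠ j + 1 := by omega
      simp [this]

/-- The operator `e_j` (`strict = true`) or `ê_j` (`strict = false`). -/
def genOp (strict : Bool) (n j : ℕ) (x : KPf) : Option KPf :=
  bif strict then eop n j x else ehat n j x

lemma genOp_eq {n j : ℕ} {x : KPf} (strict : Bool) (hx : IsKP n x) (hj : j < n) :
    genOp strict n j x =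
      if (rowSig n j x).2 + (x (j, j + 1) - (rowSig n j x).1) ≤ (colSig j x).1 - x (j, j + 1) then
        if (colSig j x).1 < x (j, j + 1) then
          bif strict then none else some (KPsub x (j, j + 1))
        else (colHead j x).map (fun h => KPmove x (h, j + 1) (h, j))
      else if (rowSig n j x).1 < x (j, j + 1) then
        bif strict then none else some (KPsub x (j, j + 1))
      else (rowHead n j x).map (fun c => KPmove x (j, c) (j + 1, c)) := by
  obtain ⟨h1, h2, h3⟩ := Wword_stats hx hj
  obtain ⟨h4, h5⟩ := Wstar_stats hx hj
  have e1 := etilde_eq hx hj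
  have e2 := etildeS_eq hx hj
  simp only [genOp, eop, ehat, h1, h2, h3, h4, h5, e1, e2]
  by_cases c1 : (rowSig n j x).2 + (x (j, j + 1) - (rowSig n j x).1) ≤
      (colSig j x).1 - x (j, j + 1)
  · simp only [c1, if_true]
    by_cases c2 : (colSig j x).1 < x (j, j + 1)
    · have hpos : 0 < (colSig j x).2 + (x (j, j + 1) - (colSig j x).1) := by omega
      cases strict <;> simp [c2, hpos]
    · simp only [c2, if_false]
      rcases hh : colHead j x with _ | k
      · cases strict <;> simp
      · have hk := colHead_lt hh
        have hpos : 0 < (colSig j x).2 + (x (j, j + 1) - (colSig j x).1) :=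
          Nat.add_pos_left (headIdx_spec hh).2.2 _
        cases strict <;> simp only [hpos] <;> simp [hk.ne]
  · simp only [c1, if_false]
    by_cases c2 : (rowSig n j x).1 < x (j, j + 1)
    · cases strict <;> simp [c2]
    · simp only [c2, if_false]
      rcases hh : rowHead n j x with _ | k
      · cases strict <;> simp
      · have hk := rowHead_gt hh
        have : k ≠ j + 1 := by omega
        cases strict <;> simp [this]

/-! ### The numerical data governing the `j`-strings -/

/-- The multiplicity of the simple root and the signatures of the rest of `W_j` and `W_j*`. -/
def dat (n j : ℕ) (x : KPf) : ℕ × (ℕ × ℕ) × (ℕ × ℕ) := (x (j, j + 1), colSig j x, rowSig n j x)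

/-- The effect of `e_j` or `ê_j` on the numerical data. -/
def datStep (strict : Bool) (d : ℕ × (ℕ × ℕ) × (ℕ × ℕ)) : Option (ℕ × (ℕ × ℕ) × (ℕ × ℕ)) :=
  if d.2.2.2 + (d.1 - d.2.2.1) ≤ d.2.1.1 - d.1 then
    if d.2.1.1 < d.1 then bif strict then none else some (d.1 - 1, d.2)
    else if d.2.1.2 = 0 then none else some (d.1, (d.2.1.1 + 1, d.2.1.2 - 1), d.2.2)
  else if d.2.2.1 < d.1 then bif strict then none else some (d.1 - 1, d.2)
  else if d.2.2.2 = 0 then none else some (d.1, d.2.1, (d.2.2.1 + 1, d.2.2.2 - 1))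

lemma dat_KPsub (n j : ℕ) (x : KPf) :
    dat n j (KPsub x (j, j + 1)) = (x (j, j + 1) - 1, (dat n j x).2) := by
  have h1 : colSig j (KPsub x (j, j + 1)) = colSig j x := sig_congr (by
    intro a ha
    have : a < j := by simpa using ha
    simp [KPsub, this.ne])
  have h2 : rowSig n j (KPsub x (j, j + 1)) = rowSig n j x := sig_congr (by
    intro a ha
    rw [List.mem_range'_1] at ha
    have : a ≠ j + 1 := by omega
    simp [KPsub, this])
  simp [dat, h1, h2, KPsub]

lemma KPmove_apply {x : KPf} {r r' : Root} (hr : r ≠ r') (p : Root) :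
    KPmove x r r' p = if p = r then x r - 1 else if p = r' then x r' + 1 else x p := by
  unfold KPmove KPadd KPsub
  split_ifs <;> simp_all

lemma dat_KPmove_col {n j h : ℕ} {x : KPf} (hh : colHead j x = some h) :
    dat n j (KPmove x (h, j + 1) (h, j)) =
      (x (j, j + 1), ((colSig j x).1 + 1, (colSig j x).2 - 1), rowSig n j x) := by
  have hlt := colHead_lt hh
  have h0 := KPmove_apply (x := x) (r := (h, j + 1)) (r' := (h, j)) (by simp)
  have h1 : colSig j (KPmove x (h, j + 1) (h, j)) = ((colSig j x).1 + 1, (colSig j x).2 - 1) :=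
    sig_headIdx (List.nodup_reverse.2 List.nodup_range) hh (by simp [h0]) (by simp [h0])
      (by intro a ha; simp [h0, ha])
  have h2 : rowSig n j (KPmove x (h, j + 1) (h, j)) = rowSig n j x := sig_congr (by
    intro a ha
    simp [h0, hlt.ne', show j + 1 ≠ h by omega])
  simp [dat, h1, h2, h0, hlt.ne']

lemma dat_KPmove_row {n j c : ℕ} {x : KPf} (hh : rowHead n j x = some c) :
    dat n j (KPmove x (j, c) (j + 1, c)) =
      (x (j, j + 1), colSig j x, ((rowSig n j x).1 + 1, (rowSig n j x).2 - 1)) := by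
  have hlt := rowHead_gt hh
  have h0 := KPmove_apply (x := x) (r := (j, c)) (r' := (j + 1, c)) (by simp)
  have h1 : rowSig n j (KPmove x (j, c) (j + 1, c)) =
      ((rowSig n j x).1 + 1, (rowSig n j x).2 - 1) :=
    sig_headIdx List.nodup_range' hh (by simp [h0]) (by simp [h0])
      (by intro a ha; simp [h0, ha])
  have h2 : colSig j (KPmove x (j, c) (j + 1, c)) = colSig j x := sig_congr (by
    intro a ha
    simp [h0, show j ≠ c by omega, show j + 1 ≠ c by omega])
  simp [dat, h1, h2, h0, show j + 1 ≠ c by omega]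

lemma map_dat_genOp {n j : ℕ} {x : KPf} (strict : Bool) (hx : IsKP n x) (hj : j < n) :
    (genOp strict n j x).map (dat n j) = datStep strict (dat n j x) := by
  rw [genOp_eq strict hx hj]
  simp only [datStep]
  simp only [show (dat n j x).1 = x (j, j + 1) from rfl, show (dat n j x).2.1 = colSig j x from rfl,
    show (dat n j x).2.2 = rowSig n j x from rfl]
  split_ifs with c1 c2 c3 c4 c5
  · cases strict <;> simp [dat_KPsub]
  · rcases hh : colHead j x with _ | k
    · rfl
    · exact absurd ‹_ = 0› (headIdx_spec hh).2.2.ne'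
  · rcases hh : colHead j x with _ | k
    · exact absurd (headIdx_eq_none hh) c3
    · simp [dat_KPmove_col hh]
  · cases strict <;> simp [dat_KPsub]
  · rcases hh : rowHead n j x with _ | k
    · rfl
    · exact absurd ‹_ = 0› (headIdx_spec hh).2.2.ne'
  · rcases hh : rowHead n j x with _ | k
    · exact absurd (headIdx_eq_none hh) c5
    · simp [dat_KPmove_row hh]

lemma IsKP.sub {n : ℕ} {x : KPf} (hx : IsKP n x) (r : Root) : IsKP n (KPsub x r) := by
  intro p hp
  refine hx p fun h => hp ?_
  simp [KPsub, h]

lemma IsKP.move {n : ℕ} {x : KPf} (hx : IsKP n x) (r : Root) {r' : Root} (hr : IsPos n r') :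
    IsKP n (KPmove x r r') := by
  intro p hp
  by_cases h : p = r'
  · rwa [h]
  · exact hx.sub r p (by simpa [KPmove, KPadd, h] using hp)

lemma isKP_genOp {n j : ℕ} {x y : KPf} {strict : Bool} (hx : IsKP n x) (hj : j < n)
    (h : genOp strict n j x = some y) : IsKP n y := by
  rw [genOp_eq strict hx hj] at h
  have hsub : (bif strict then none else some (KPsub x (j, j + 1))) = some y → IsKP n y := by
    cases strict
    · simp only [cond_false, Option.some.injEq]
      rintro rfl
      exact hx.sub _
    · simp
  split_ifs at h with c1 c2 c3
  · exact hsub h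
  · obtain ⟨k, hk, rfl⟩ := Option.map_eq_some_iff.1 h
    have hp := hx (k, j + 1) (headIdx_spec hk).2.1.ne'
    exact hx.move _ ⟨hp.1, colHead_lt hk, hj.le⟩
  · exact hsub h
  · obtain ⟨k, hk, rfl⟩ := Option.map_eq_some_iff.1 h
    have hp := hx (j, k) (headIdx_spec hk).2.1.ne'
    have := rowHead_gt hk
    exact hx.move _ ⟨by simp, by simp only; omega, hp.2.2⟩

lemma iterO_genOp_congr {n j : ℕ} {x y : KPf} (strict : Bool) (hj : j < n)
    (hx : IsKP n x) (hy : IsKP n y) (hxy : dat n j x = dat n j y) (k : ℕ) :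
    iterO (genOp strict n j) k x = none ↔ iterO (genOp strict n j) k y = none := by
  induction k generalizing x y with
  | zero => simp [iterO]
  | succ k ih =>
    have h := (map_dat_genOp strict hx hj).trans
      ((congrArg (datStep strict) hxy).trans (map_dat_genOp strict hy hj).symm)
    rcases hgx : genOp strict n j x with _ | x' <;> rcases hgy : genOp strict n j y with _ | y'
    · simp [iterO, hgx, hgy]
    · simp [hgx, hgy] at h
    · simp [hgx, hgy] at h
    · rw [hgx, hgy] at h
      simpa [iterO, hgx, hgy] using
        ih (isKP_genOp hx hj hgx) (isKP_genOp hy hj hgy) (Option.some.inj h)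

lemma range'_split {a m i : ℕ} (h1 : a ≤ i) (h2 : i + 1 < a + m) :
    ∃ L M, List.range' a m = L ++ i :: (i + 1) :: M := by
  obtain ⟨p, rfl⟩ := Nat.exists_eq_add_of_le h1
  obtain ⟨q, rfl⟩ : ∃ q, m = p + (q + 2) := ⟨m - p - 2, by omega⟩
  refine ⟨List.range' a p, List.range' (a + p + 2) q, ?_⟩
  rw [← List.range'_append_1, List.range'_succ, List.range'_succ]

lemma colIdx_split {i j : ℕ} (h : i + 1 < j) : ∃ L M, colIdx j = L ++ (i + 1) :: i :: M := by
  obtain ⟨L, M, hLM⟩ := range'_split (a := 0) (m := j) (Nat.zero_le i) (by omega)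
  refine ⟨M.reverse, L.reverse, ?_⟩
  rw [colIdx, List.range_eq_range', hLM]
  simp

lemma rowIdx_split {n i j : ℕ} (h : j + 1 < i) (hi : i < n) :
    ∃ L M, rowIdx n j = L ++ i :: (i + 1) :: M :=
  range'_split (by omega) (by omega)

lemma nodup_colIdx (j : ℕ) : (colIdx j).Nodup := List.nodup_reverse.2 List.nodup_range

lemma nodup_rowIdx (n j : ℕ) : (rowIdx n j).Nodup := List.nodup_range'

lemma dat_KPmove_col_of_far {n i j h : ℕ} {x : KPf} (hi : i < n) (hij : i + 1 < j ∨ j + 1 < i)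
    (hh : colHead i x = some h) : dat n j (KPmove x (h, i + 1) (h, i)) = dat n j x := by
  have hlt := colHead_lt hh
  have h0 := KPmove_apply (x := x) (r := (h, i + 1)) (r' := (h, i)) (by simp)
  have n1 : j ≠ i := by omega
  have n2 : j ≠ i + 1 := by omega
  have n3 : j + 1 ≠ i := by omega
  have h1 : colSig j (KPmove x (h, i + 1) (h, i)) = colSig j x := sig_congr (by
    intro a ha
    simp [h0, n1, n2, n3])
  have h2 : rowSig n j (KPmove x (h, i + 1) (h, i)) = rowSig n j x := by
    by_cases hc : h = j ∨ h = j + 1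
    · have hji : j + 1 < i := by omega
      obtain ⟨L, M, hL⟩ := colIdx_split hji
      have hadj := headIdx_adjacent (P := fun h => x (h, i)) (Q := fun h => x (h, i + 1))
        (hL ▸ nodup_colIdx i)
      rw [← hL] at hadj
      obtain ⟨L', M', hL'⟩ := rowIdx_split hji hi
      rw [rowSig, rowSig, hL']
      refine sig_adjacent (hL' ▸ nodup_rowIdx n j) ?_ ?_
      · intro a ha ha'
        simp [h0, ha, ha']
      · rcases hc with rfl | rfl
        · have := hadj.2 hh
          right
          simp [h0, this]
        · have := hadj.1 hh
          left
          simp [h0, this]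
    · exact sig_congr (by
        intro a ha
        have : j ≠ h := by omega
        have : j + 1 ≠ h := by omega
        simp [*])
  simp [dat, h1, h2, h0, n1, n3]

lemma dat_KPmove_row_of_far {n i j c : ℕ} {x : KPf} (hj : j < n) (hij : i + 1 < j ∨ j + 1 < i)
    (hc : rowHead n i x = some c) : dat n j (KPmove x (i, c) (i + 1, c)) = dat n j x := by
  have hgt := rowHead_gt hc
  have h0 := KPmove_apply (x := x) (r := (i, c)) (r' := (i + 1, c)) (by simp)
  have n1 : j ≠ i := by omega
  have n2 : j ≠ i + 1 := by omega
  have n3 : j + 1 ≠ i := by omega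
  have h1 : rowSig n j (KPmove x (i, c) (i + 1, c)) = rowSig n j x := sig_congr (by
    intro a ha
    simp [h0, n1, n2, n3])
  have h2 : colSig j (KPmove x (i, c) (i + 1, c)) = colSig j x := by
    by_cases hcj : c = j ∨ c = j + 1
    · have hji : i + 1 < j := by omega
      obtain ⟨L, M, hL⟩ := rowIdx_split hji hj
      have hadj := headIdx_adjacent (P := fun c => x (i + 1, c)) (Q := fun c => x (i, c))
        (hL ▸ nodup_rowIdx n i)
      rw [← hL] at hadj
      obtain ⟨L', M', hL'⟩ := colIdx_split hji
      rw [colSig, colSig, hL']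
      refine sig_adjacent (hL' ▸ nodup_colIdx j) ?_ ?_
      · intro a ha ha'
        simp [h0, ha, ha']
      · rcases hcj with rfl | rfl
        · have := hadj.1 hc
          left
          simp [h0, this]
        · have := hadj.2 hc
          right
          simp [h0, this]
    · exact sig_congr (by
        intro a ha
        have : j ≠ c := by omega
        have : j + 1 ≠ c := by omega
        simp [*])
  simp [dat, h1, h2, h0, n1, n2]

lemma dat_eop_of_far {n i j : ℕ} {x y : KPf} (hx : IsKP n x) (hi : i < n) (hj : j < n)
    (hij : i + 1 < j ∨ j + 1 < i) (h : eop n i x = some y) : dat n j y = dat n j x := by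
  have h' : genOp true n i x = some y := h
  rw [genOp_eq true hx hi] at h'
  split_ifs at h' with c1 c2 c3
  · simp at h'
  · obtain ⟨k, hk, rfl⟩ := Option.map_eq_some_iff.1 h'
    exact dat_KPmove_col_of_far hi hij hk
  · simp at h'
  · obtain ⟨k, hk, rfl⟩ := Option.map_eq_some_iff.1 h'
    exact dat_KPmove_row_of_far hj hij hk

end KFC

open KFC in
/-- Stembridge axiom S1 (orthogonal case) for the modified operators, for both
string statistics: if `|i−j| > 1` and `e_i(x) ≠ 0`, then `ε_j(e_i(x)) = ε_j(x)`
and `ε̂_j(e_i(x)) = ε̂_j(x)`. -/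
theorem stmt10 (n : ℕ) (hn : 2 ≤ n) (i j : ℕ)
    (hi1 : 1 ≤ i) (hi2 : i ≤ n - 1) (hj1 : 1 ≤ j) (hj2 : j ≤ n - 1) (hij : i + 1 < j ∨ j + 1 < i)
    (x : KPf) (hx : IsKP n x) (he : eop n i x ≠ none) :
    epsO n j (eop n i x) = epsS n j x ∧ epsHatO n j (eop n i x) = epsHatS n j x := by
  obtain ⟨y, hy⟩ := Option.ne_none_iff_exists'.1 he
  have hi : i < n := by omega
  have hj : j < n := by omega
  have hyK : IsKP n y := isKP_genOp (strict := true) hx hi hy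
  have hd := dat_eop_of_far hx hi hj hij hy
  rw [hy]
  constructor
  · exact congrArg sSup (Set.ext fun k =>
      not_congr (iterO_genOp_congr true hj hyK hx hd k))
  · exact congrArg sSup (Set.ext fun k =>
      not_congr (iterO_genOp_congr false hj hyK hx hd k))
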